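/- Let K be a field of characteristic 2 and λ ∈ K such that the polynomial t² + λ·t + 1 has no root in K. Let V = K^6 and χ := [126] + [153] + [234] + (λ² + 1)·[456] + λ·([156] + [345] + [426]). Then dim Rad_χ(u) = 2 for every nonzero u ∈ V; consequently the upper radical R↑(χ) = {Rad_χ(u) : u ∈ V, u ≠ 0} is a line spread of the projective space of V (every nonzero vector lies in exactly one member of R↑(χ)). -/

import Mathlib

open Module

/-- The radical of a point `u` with respect to an alternating trilinear form `χ` on `V`:
the subspace `Rad_χ(u) = {v ∈ V | χ(u, v, x) = 0 for all x ∈ V}`. -/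
def trilinRad {K V : Type*} [Field K] [AddCommGroup V] [Module K V]
    (χ : AlternatingMap K V K (Fin 3)) (u : V) : Submodule K V where
  carrier := {v | ∀ x : V, χ ![u, v, x] = 0}
  add_mem' := by
    intro a b ha hb x
    have h1 : (![u, a + b, x] : Fin 3 → V) = Function.update ![u, a, x] 1 (a + b) := by
      funext i; fin_cases i <;> simp
    have h2 : Function.update (![u, a, x] : Fin 3 → V) 1 a = ![u, a, x] := by
      funext i; fin_cases i <;> simp
    have h3 : Function.update (![u, a, x] : Fin 3 → V) 1 b = ![u, b, x] := by
      funext i; fin_cases i <;> simp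
    calc χ ![u, a + b, x]
        = χ (Function.update ![u, a, x] 1 (a + b)) := by rw [h1]
      _ = χ (Function.update ![u, a, x] 1 a) + χ (Function.update ![u, a, x] 1 b) := by
          rw [AlternatingMap.map_update_add]
      _ = 0 := by rw [h2, h3, ha x, hb x, add_zero]
  zero_mem' := by
    intro x
    exact AlternatingMap.map_coord_zero χ 1 (by simp)
  smul_mem' := by
    intro c a ha x
    have h1 : (![u, c • a, x] : Fin 3 → V) = Function.update ![u, a, x] 1 (c • a) := by
      funext i; fin_cases i <;> simp
    have h2 : Function.update (![u, a, x] : Fin 3 → V) 1 a = ![u, a, x] := by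
      funext i; fin_cases i <;> simp
    rw [h1, AlternatingMap.map_update_smul, h2, ha x, smul_zero]

/-- The basic alternating trilinear form `[ijk]` on `K^n`, sending `(x, y, z)` to the
determinant of the 3×3 matrix with rows `(x i, x j, x k)`, `(y i, y j, y k)`,
`(z i, z j, z k)`.  (Indices are 0-based: the form written `[123]` in the paper is
`trip 0 1 2`.) -/
noncomputable def trip {K : Type*} [Field K] {n : ℕ} (i j k : Fin n) :
    AlternatingMap K (Fin n → K) K (Fin 3) :=
  (Matrix.detRowAlternating : AlternatingMap K (Fin 3 → K) K (Fin 3)).compLinearMap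
    (LinearMap.funLeft K K ![i, j, k])

/-- Multiplication by a root `ω` of `t² + λt + 1` on `K^6`, identified with `K(ω)^3` by taking
`(e_1, e_2, e_3, ω e_1, ω e_2, ω e_3)` as a `K`-basis. -/
def omegaMul {K : Type*} [Field K] (lam : K) (u : Fin 6 → K) : Fin 6 → K :=
  ![u 3, u 4, u 5, u 0 + lam * u 3, u 1 + lam * u 4, u 2 + lam * u 5]

/-- The form `[126] + [153] + [234] + (λ²+1)[456] + λ([156] + [345] + [426])` on `K^6`. -/
noncomputable def spreadForm {K : Type*} [Field K] (lam : K) :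
    AlternatingMap K (Fin 6 → K) K (Fin 3) :=
  trip 0 1 5 + trip 0 4 2 + trip 1 2 3 + (lam ^ 2 + 1) • trip 3 4 5 +
    lam • (trip 0 4 5 + trip 2 3 4 + trip 3 1 5)

section

variable {K : Type*} [Field K]

theorem trip_apply {n : ℕ} (i j k : Fin n) (u v x : Fin n → K) :
    trip i j k ![u, v, x] = u i * v j * x k - u i * v k * x j - u j * v i * x k +
      u j * v k * x i + u k * v i * x j - u k * v j * x i := by
  change Matrix.det (Matrix.of fun r : Fin 3 =>
    LinearMap.funLeft K K ![i, j, k] (![u, v, x] r)) = _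
  rw [Matrix.det_fin_three]
  simp [LinearMap.funLeft_apply]

/-- The `1`-coordinate of the `(i, j)` minor of `u, v`, with `i', j'` indexing the
`ω`-coordinates. -/
def minorRe (u v : Fin 6 → K) (i j i' j' : Fin 6) : K :=
  u i' * v j' + u j' * v i' + u i * v j + u j * v i

/-- The `ω`-coordinate of the `(i, j)` minor of `u, v`, with `i', j'` indexing the
`ω`-coordinates. -/
def minorIm (lam : K) (u v : Fin 6 → K) (i j i' j' : Fin 6) : K :=
  u i * v j' + u i' * v j + u j * v i' + u j' * v i + lam * (u i' * v j' + u j' * v i')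

theorem quadratic_form_ne_zero {lam : K} (hlam : ∀ x : K, x ^ 2 + lam * x + 1 ≠ 0) {a b : K}
    (h : a ≠ 0 ∨ b ≠ 0) : a ^ 2 + lam * a * b + b ^ 2 ≠ 0 := by
  intro h0
  by_cases hb : b = 0
  · simp_all
  · apply hlam (a / b)
    field_simp
    linear_combination h0

variable [CharP K 2]

theorem spreadForm_apply (lam : K) (u v x : Fin 6 → K) :
    spreadForm lam ![u, v, x] =
      x 0 * minorIm lam u v 1 2 4 5 + x 1 * minorIm lam u v 2 0 5 3 +
      x 2 * minorIm lam u v 0 1 3 4 +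
      x 3 * (minorRe u v 1 2 4 5 + lam * minorIm lam u v 1 2 4 5) +
      x 4 * (minorRe u v 2 0 5 3 + lam * minorIm lam u v 2 0 5 3) +
      x 5 * (minorRe u v 0 1 3 4 + lam * minorIm lam u v 0 1 3 4) := by
  simp only [spreadForm, AlternatingMap.add_apply, AlternatingMap.smul_apply, smul_eq_mul,
    trip_apply, CharTwo.sub_eq_add, minorRe, minorIm]
  have h2 : (2 : K) = 0 := CharTwo.two_eq_zero
  grind

theorem mem_trilinRad_spreadForm {lam : K} {u v : Fin 6 → K} :
    v ∈ trilinRad (spreadForm lam) u ↔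
      (minorRe u v 0 1 3 4 = 0 ∧ minorIm lam u v 0 1 3 4 = 0) ∧
      (minorRe u v 1 2 4 5 = 0 ∧ minorIm lam u v 1 2 4 5 = 0) ∧
      (minorRe u v 2 0 5 3 = 0 ∧ minorIm lam u v 2 0 5 3 = 0) := by
  change (∀ x, spreadForm lam ![u, v, x] = 0) ↔ _
  simp only [spreadForm_apply]
  constructor
  · intro h
    have h0 := h (Pi.single 0 1)
    have h1 := h (Pi.single 1 1)
    have h2 := h (Pi.single 2 1)
    have h3 := h (Pi.single 3 1)
    have h4 := h (Pi.single 4 1)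
    have h5 := h (Pi.single 5 1)
    simp at h0 h1 h2 h3 h4 h5
    simp_all
  · rintro ⟨⟨h1, h2⟩, ⟨h3, h4⟩, h5, h6⟩ x
    simp [h1, h2, h3, h4, h5, h6]

theorem comb_mem_trilinRad_comb (lam a b c d : K) (u : Fin 6 → K) :
    c • u + d • omegaMul lam u ∈ trilinRad (spreadForm lam) (a • u + b • omegaMul lam u) := by
  have h2 : (2 : K) = 0 := CharTwo.two_eq_zero
  rw [mem_trilinRad_spreadForm]
  simp [minorRe, minorIm, omegaMul]
  refine ⟨⟨?_, ?_⟩, ⟨?_, ?_⟩, ?_, ?_⟩ <;> grind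

/-- If `u` has a nonzero `i`-th coordinate over `K(ω)` and the minors of `u, v` involving `i`
vanish, then `v` is the multiple of `u` by some `a + b ω`. -/
theorem exists_comb {lam : K} (hlam : ∀ x : K, x ^ 2 + lam * x + 1 ≠ 0) (u v : Fin 6 → K)
    (i j k i' j' k' : Fin 6) (hi : u i ≠ 0 ∨ u i' ≠ 0)
    (h1 : minorRe u v i j i' j' = 0) (h2 : minorIm lam u v i j i' j' = 0)
    (h3 : minorRe u v k i k' i' = 0) (h4 : minorIm lam u v k i k' i' = 0) :
    ∃ a b : K, (v i = a * u i + b * u i' ∧ v i' = a * u i' + b * (u i + lam * u i')) ∧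
      (v j = a * u j + b * u j' ∧ v j' = a * u j' + b * (u j + lam * u j')) ∧
      (v k = a * u k + b * u k' ∧ v k' = a * u k' + b * (u k + lam * u k')) := by
  have hN := quadratic_form_ne_zero hlam hi
  have hc : (2 : K) = 0 := CharTwo.two_eq_zero
  unfold minorRe at h1 h3
  unfold minorIm at h2 h4
  refine ⟨(v i * (u i + lam * u i') + v i' * u i') / (u i ^ 2 + lam * u i * u i' + u i' ^ 2),
    (v i * u i' + v i' * u i) / (u i ^ 2 + lam * u i * u i' + u i' ^ 2),
    ⟨?_, ?_⟩, ⟨?_, ?_⟩, ?_, ?_⟩ <;> rw [div_mul_eq_mul_div, div_mul_eq_mul_div, ← add_div,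
      eq_div_iff hN] <;> grind

theorem trilinRad_spreadForm_eq_span {lam : K} (hlam : ∀ x : K, x ^ 2 + lam * x + 1 ≠ 0)
    {u : Fin 6 → K} (hu : u ≠ 0) :
    trilinRad (spreadForm lam) u = Submodule.span K {u, omegaMul lam u} := by
  ext v
  rw [Submodule.mem_span_pair]
  constructor
  · intro hv
    obtain ⟨⟨h1, h2⟩, ⟨h3, h4⟩, h5, h6⟩ := mem_trilinRad_spreadForm.1 hv
    have hne : (u 0 ≠ 0 ∨ u 3 ≠ 0) ∨ (u 1 ≠ 0 ∨ u 4 ≠ 0) ∨ (u 2 ≠ 0 ∨ u 5 ≠ 0) := by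
      by_contra! h
      apply hu
      ext i
      fin_cases i <;> simp [h]
    obtain h | h | h := hne
    · obtain ⟨a, b, ⟨e1, e2⟩, ⟨e3, e4⟩, e5, e6⟩ :=
        exists_comb hlam u v 0 1 2 3 4 5 h h1 h2 h5 h6
      refine ⟨a, b, ?_⟩
      ext i
      fin_cases i <;> simp [omegaMul, *]
    · obtain ⟨a, b, ⟨e1, e2⟩, ⟨e3, e4⟩, e5, e6⟩ :=
        exists_comb hlam u v 1 2 0 4 5 3 h h3 h4 h1 h2
      refine ⟨a, b, ?_⟩
      ext i
      fin_cases i <;> simp [omegaMul, *]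
    · obtain ⟨a, b, ⟨e1, e2⟩, ⟨e3, e4⟩, e5, e6⟩ :=
        exists_comb hlam u v 2 0 1 5 3 4 h h5 h6 h3 h4
      refine ⟨a, b, ?_⟩
      ext i
      fin_cases i <;> simp [omegaMul, *]
  · rintro ⟨a, b, rfl⟩
    simpa using comb_mem_trilinRad_comb lam 1 0 a b u

theorem linearIndependent_omegaMul {lam : K} (hlam : ∀ x : K, x ^ 2 + lam * x + 1 ≠ 0)
    {u : Fin 6 → K} (hu : u ≠ 0) : LinearIndependent K ![u, omegaMul lam u] := by
  rw [LinearIndependent.pair_iff]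
  intro a b h
  have hc : (2 : K) = 0 := CharTwo.two_eq_zero
  by_contra hab
  have hN := quadratic_form_ne_zero hlam (a := a) (b := b) (by tauto)
  apply hu
  have key (x y : K) (hx : a * x + b * y = 0) (hy : a * y + b * (x + lam * y) = 0) :
      x = 0 ∧ y = 0 := by
    constructor <;> apply (mul_eq_zero_iff_left hN).1 <;> grind
  have e (i : Fin 6) := congrFun h i
  have k0 := key (u 0) (u 3) (by simpa [omegaMul] using e 0) (by simpa [omegaMul] using e 3)
  have k1 := key (u 1) (u 4) (by simpa [omegaMul] using e 1) (by simpa [omegaMul] using e 4)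
  have k2 := key (u 2) (u 5) (by simpa [omegaMul] using e 2) (by simpa [omegaMul] using e 5)
  ext i
  fin_cases i <;> simp [k0, k1, k2]

theorem finrank_trilinRad_spreadForm {lam : K} (hlam : ∀ x : K, x ^ 2 + lam * x + 1 ≠ 0)
    {u : Fin 6 → K} (hu : u ≠ 0) : finrank K (trilinRad (spreadForm lam) u) = 2 := by
  have h := finrank_span_eq_card (linearIndependent_omegaMul hlam hu)
  rw [trilinRad_spreadForm_eq_span hlam hu]
  rwa [Matrix.range_cons_cons_empty, Fintype.card_fin] at h

theorem trilinRad_spreadForm_eq_of_mem {lam : K} (hlam : ∀ x : K, x ^ 2 + lam * x + 1 ≠ 0)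
    {u v : Fin 6 → K} (hu : u ≠ 0) (hv : v ≠ 0) (h : v ∈ trilinRad (spreadForm lam) u) :
    trilinRad (spreadForm lam) u = trilinRad (spreadForm lam) v := by
  apply Submodule.eq_of_le_of_finrank_eq
  · rw [trilinRad_spreadForm_eq_span hlam hu, Submodule.mem_span_pair] at h
    obtain ⟨a, b, rfl⟩ := h
    intro w hw
    rw [trilinRad_spreadForm_eq_span hlam hu, Submodule.mem_span_pair] at hw
    obtain ⟨c, d, rfl⟩ := hw
    exact comb_mem_trilinRad_comb lam a b c d u
  · rw [finrank_trilinRad_spreadForm hlam hu, finrank_trilinRad_spreadForm hlam hv]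

end

/-- for `K` of characteristic 2 and `λ ∈ K` such that `t² + λt + 1` has no
root in `K`, the form `χ = [126] + [153] + [234] + (λ²+1)[456] + λ([156] + [345] + [426])`
on `K^6` satisfies `dim Rad_χ(u) = 2` for all nonzero `u`, and the radicals form a line
spread: every nonzero vector lies in exactly one subspace `Rad_χ(u)`, `u ≠ 0`. -/
theorem stmt13 (K : Type*) [Field K] [CharP K 2] (lam : K)
    (hlam : ∀ x : K, x ^ 2 + lam * x + 1 ≠ 0)
    (χ : AlternatingMap K (Fin 6 → K) K (Fin 3))
    (hχ : χ = trip 0 1 5 + trip 0 4 2 + trip 1 2 3 + (lam ^ 2 + 1) • trip 3 4 5 +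
      lam • (trip 0 4 5 + trip 2 3 4 + trip 3 1 5)) :
    (∀ u : Fin 6 → K, u ≠ 0 → Module.finrank K (trilinRad χ u) = 2) ∧
    (∀ v : Fin 6 → K, v ≠ 0 →
      ∃! ℓ : Submodule K (Fin 6 → K),
        (∃ u : Fin 6 → K, u ≠ 0 ∧ ℓ = trilinRad χ u) ∧ v ∈ ℓ) := by
  obtain rfl : χ = spreadForm lam := hχ
  refine ⟨fun u hu => finrank_trilinRad_spreadForm hlam hu, fun v hv => ?_⟩
  refine ⟨trilinRad (spreadForm lam) v, ⟨⟨v, hv, rfl⟩, ?_⟩, ?_⟩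
  · simpa using comb_mem_trilinRad_comb lam 1 0 1 0 v
  · rintro ℓ ⟨⟨u, hu, rfl⟩, h⟩
    exact trilinRad_spreadForm_eq_of_mem hlam hu hv h
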